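/- arXiv:2005.10862 — 4 statements merged into one kernel-verified Lean document; each statement's English description precedes it below -/
import Mathlib

section
/- Let n ≥ 1 and let S : Fin n × Fin n → Fin n be a Latin square, i.e. for each fixed i the map j ↦ S(i,j) is a bijection of Fin n, and for each fixed j the map i ↦ S(i,j) is a bijection of Fin n. Define G : (Fin n × Fin n) × (Fin n × Fin n) → Fin n × Fin n by G((i,a),(b,j)) = (S(a,b), S(i,j)). Then G is a Sudoku square of size n²: (1) for each row index (i,a), the map (b,j) ↦ G((i,a),(b,j)) is a bijection of Fin n × Fin n; (2) for each column index (b,j), the map (i,a) ↦ G((i,a),(b,j)) is a bijection of Fin n × Fin n; (3) for each block (i,b) ∈ Fin n × Fin n, the map (a,j) ↦ G((i,a),(b,j)) is a bijection of Fin n × Fin n. -/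
/-- Given a Latin square `S` of size `n` (each row map `j ↦ S(i,j)` and each column
map `i ↦ S(i,j)` is a bijection of `Fin n`), the shift-and-copy square
`G((i,a),(b,j)) = (S(a,b), S(i,j))` is a Sudoku square of size `n²`: its restriction
to every row `(i,a)`, every column `(b,j)`, and every block `(i,b)` is a bijection of
`Fin n × Fin n`. -/
theorem latin_shift_copy_is_sudoku (n : ℕ) (hn : 1 ≤ n)
    (S : Fin n × Fin n → Fin n)
    (hrow : ∀ i : Fin n, Function.Bijective fun j : Fin n => S (i, j))
    (hcol : ∀ j : Fin n, Function.Bijective fun i : Fin n => S (i, j)) :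
    (∀ i a : Fin n, Function.Bijective
      fun bj : Fin n × Fin n => ((S (a, bj.1), S (i, bj.2)) : Fin n × Fin n)) ∧
    (∀ b j : Fin n, Function.Bijective
      fun ia : Fin n × Fin n => ((S (ia.2, b), S (ia.1, j)) : Fin n × Fin n)) ∧
    (∀ i b : Fin n, Function.Bijective
      fun aj : Fin n × Fin n => ((S (aj.1, b), S (i, aj.2)) : Fin n × Fin n)) := by
  exact ⟨fun i a => (hrow a).prodMap (hrow i),
    fun b j => ((hcol b).prodMap (hcol j)).comp Prod.swap_bijective,
    fun i b => (hcol b).prodMap (hrow i)⟩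
end

section
/- There exists a classical Sudoku grid of size 4 that admits a purely quantum solution: concretely, the partial 4 × 4 grid with rows (e₁, e₂, e₃, e₄), (e₃, e₄, ·, ·), (e₄, e₃, ·, ·), (e₂, e₁, e₄, e₃) (entries marked · empty) extends to a SudoQ square of size 4 in which the entry at position (2,3) equals (e₁ + e₂)/√2, which is not a scalar multiple of any standard basis vector. -/
/-- A family of vectors forms an orthonormal basis: it is orthonormal and spans. -/
def IsONB {ι κ : Type*} [Fintype κ] (v : ι → EuclideanSpace ℂ κ) : Prop :=
  Orthonormal ℂ v ∧ Submodule.span ℂ (Set.range v) = ⊤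

/-- The standard basis of `ℂ⁴`. -/
noncomputable def E (k : Fin 4) : EuclideanSpace ℂ (Fin 4) :=
  EuclideanSpace.single k 1

/-- Index of row/column number `i` inside block number `I`, for the `2 × 2` blocks
of a `4 × 4` grid. -/
def finJoin (I i : Fin 2) : Fin 4 := ⟨2 * I.val + i.val, by omega⟩

/-- A family of four orthonormal vectors in `ℂ⁴` is an orthonormal basis. -/
theorem Orthonormal.isONB {ι : Type*} [Fintype ι] {v : ι → EuclideanSpace ℂ (Fin 4)}
    (hv : Orthonormal ℂ v) (hι : Fintype.card ι = 4) : IsONB v :=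
  ⟨hv, hv.linearIndependent.span_eq_top_of_card_eq_finrank' (by simp [hι])⟩

/-- The six vectors `e₁, e₂, e₃, e₄, (e₁ + e₂)/√2, (e₁ - e₂)/√2` of the quantum solution. -/
noncomputable def palette : Fin 6 → EuclideanSpace ℂ (Fin 4) :=
  ![E 0, E 1, E 2, E 3,
    ((Real.sqrt 2 : ℂ))⁻¹ • (E 0 + E 1), ((Real.sqrt 2 : ℂ))⁻¹ • (E 0 - E 1)]

/-- The quantum solution, each entry given by its index in `palette`. -/
def colouring : Fin 4 → Fin 4 → Fin 6 :=
  ![![0, 1, 2, 3], ![2, 3, 4, 5], ![3, 2, 5, 4], ![1, 0, 3, 2]]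

/-- Two distinct indices of `palette` are compatible unless one is in `{0, 1}` and the other
in `{4, 5}`. -/
def Compatible (a b : Fin 6) : Prop :=
  a ≠ b ∧ ¬ (a < 2 ∧ 4 ≤ b) ∧ ¬ (b < 2 ∧ 4 ≤ a)

instance (a b : Fin 6) : Decidable (Compatible a b) :=
  inferInstanceAs (Decidable (_ ∧ _))

theorem norm_palette (a : Fin 6) : ‖palette a‖ = 1 := by
  rw [EuclideanSpace.norm_eq, Real.sqrt_eq_one]
  fin_cases a <;> simp [palette, E, Fin.sum_univ_four] <;> norm_num

theorem Compatible.inner_palette {a b : Fin 6} (hab : Compatible a b) :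
    inner ℂ (palette a) (palette b) = 0 := by
  revert hab
  fin_cases a <;> fin_cases b <;>
    first
    | exact fun hab => absurd hab (by decide)
    | (intro; simp [palette, E, PiLp.inner_apply])

/-- Four pairwise compatible indices of `palette` give an orthonormal basis. -/
theorem isONB_palette_comp {ι : Type*} [Fintype ι] (c : ι → Fin 6)
    (hι : Fintype.card ι = 4) (hc : ∀ i j, i ≠ j → Compatible (c i) (c j)) :
    IsONB fun i => palette (c i) :=
  Orthonormal.isONB ⟨fun i => norm_palette (c i), fun i j hij => (hc i j hij).inner_palette⟩ hι

theorem palette_four_ne_smul (k : Fin 4) (c : ℂ) : palette 4 ≠ c • E k := by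
  intro h
  have h0 := congrArg (fun v => v 0) h
  have h1 := congrArg (fun v => v 1) h
  fin_cases k <;> simp [palette, E] at h0 h1

/-- The partial `4 × 4` grid with rows `(e₁,e₂,e₃,e₄)`, `(e₃,e₄,·,·)`, `(e₄,e₃,·,·)`,
`(e₂,e₁,e₄,e₃)` extends to a SudoQ square of size 4 (each row, column and `2 × 2`
block an orthonormal basis of `ℂ⁴`) whose entry at position `(2,3)` equals
`(e₁ + e₂)/√2`, which is not a scalar multiple of any standard basis vector. -/
theorem purely_quantum_solution_exists :
    ∃ Q : Fin 4 → Fin 4 → EuclideanSpace ℂ (Fin 4),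
      (∀ i j, ‖Q i j‖ = 1) ∧
      (∀ i : Fin 4, IsONB fun j : Fin 4 => Q i j) ∧
      (∀ j : Fin 4, IsONB fun i : Fin 4 => Q i j) ∧
      (∀ I J : Fin 2, IsONB fun p : Fin 2 × Fin 2 =>
        Q (finJoin I p.1) (finJoin J p.2)) ∧
      Q 0 0 = E 0 ∧ Q 0 1 = E 1 ∧ Q 0 2 = E 2 ∧ Q 0 3 = E 3 ∧
      Q 1 0 = E 2 ∧ Q 1 1 = E 3 ∧
      Q 2 0 = E 3 ∧ Q 2 1 = E 2 ∧
      Q 3 0 = E 1 ∧ Q 3 1 = E 0 ∧ Q 3 2 = E 3 ∧ Q 3 3 = E 2 ∧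
      Q 1 2 = ((Real.sqrt 2 : ℂ))⁻¹ • (E 0 + E 1) ∧
      ¬ ∃ (k : Fin 4) (c : ℂ), Q 1 2 = c • E k := by
  refine ⟨fun i j => palette (colouring i j), fun i j => norm_palette _,
    fun i => isONB_palette_comp _ rfl (by revert i; decide),
    fun j => isONB_palette_comp _ rfl (by revert j; decide),
    fun I J => isONB_palette_comp _ rfl (by revert I J; decide),
    rfl, rfl, rfl, rfl, rfl, rfl, rfl, rfl, rfl, rfl, rfl, rfl, rfl, ?_⟩
  rintro ⟨k, c, h⟩
  exact palette_four_ne_smul k c h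
end

section
/- Let a : Fin 3 × Fin 3 → ℂ³ be a quantum Latin square of size 3, i.e. each a(i,j) is a unit vector and for each fixed i the triple (a(i,0), a(i,1), a(i,2)) is an orthonormal basis of ℂ³, and likewise for each fixed j the triple (a(0,j), a(1,j), a(2,j)) is an orthonormal basis of ℂ³. Assume moreover that the third column is the standard basis: a(i,2) = e_{i+1} for i = 0, 1, 2. Then every entry of a is a scalar multiple of a standard basis vector: for all i, j there exist k ∈ {1,2,3} and c ∈ ℂ with |c| = 1 such that a(i,j) = c · e_k. -/
/-- The standard basis of `ℂ³`. -/
noncomputable def E3 (k : Fin 3) : EuclideanSpace ℂ (Fin 3) :=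
  EuclideanSpace.single k 1

/-- A unit vector of `ℂ³` supported on one coordinate is a phase times a basis vector. -/
lemma exists_eq_smul_E3 {x : EuclideanSpace ℂ (Fin 3)} (hx : ‖x‖ = 1) {k : Fin 3}
    (h : ∀ l, l ≠ k → x l = 0) : ∃ c : ℂ, ‖c‖ = 1 ∧ x = c • E3 k := by
  have hxk : x = x k • E3 k := by
    ext l
    by_cases hl : l = k
    · subst hl; simp [E3]
    · simp [E3, hl, h l hl]
  refine ⟨x k, ?_, hxk⟩
  rw [hxk, norm_smul] at hx
  simpa [E3] using hx

/-- If `u` is an orthonormal triple in `ℂ³` with `u i ⟂ eᵢ` for every `i`, then each `u i` is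
supported on a single coordinate. -/
lemma Orthonormal.exists_support_singleton_of_diag_eq_zero
    {u : Fin 3 → EuclideanSpace ℂ (Fin 3)} (hu : Orthonormal ℂ u) (hdiag : ∀ i, u i i = 0)
    (i : Fin 3) : ∃ k, ∀ l, l ≠ k → u i l = 0 := by
  have hne (i : Fin 3) : ¬(u i 0 = 0 ∧ u i 1 = 0 ∧ u i 2 = 0) := by
    rintro ⟨h0, h1, h2⟩
    refine hu.ne_zero i ?_
    ext l
    fin_cases l <;> simpa
  have h00 := hdiag 0
  have h11 := hdiag 1
  have h22 := hdiag 2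
  have h01 : u 1 2 = 0 ∨ u 0 2 = 0 := by
    simpa [PiLp.inner_apply, Fin.sum_univ_three, h00, h11] using
      hu.inner_eq_zero (show (0 : Fin 3) ≠ 1 by decide)
  have h02 : u 2 1 = 0 ∨ u 0 1 = 0 := by
    simpa [PiLp.inner_apply, Fin.sum_univ_three, h00, h22] using
      hu.inner_eq_zero (show (0 : Fin 3) ≠ 2 by decide)
  have h12 : u 2 0 = 0 ∨ u 1 0 = 0 := by
    simpa [PiLp.inner_apply, Fin.sum_univ_three, h11, h22] using
      hu.inner_eq_zero (show (1 : Fin 3) ≠ 2 by decide)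
  have hne0 := hne 0
  have hne1 := hne 1
  have hne2 := hne 2
  simp only [Fin.exists_fin_succ, Fin.forall_fin_succ]
  fin_cases i <;> simp <;> tauto

/-- Every quantum Latin square of size 3 (each entry a unit vector, each row and
each column an orthonormal basis of `ℂ³`) whose third column is the standard basis
`a(i,2) = e_{i+1}` has all entries scalar multiples of standard basis vectors. -/
theorem qls_three_with_classical_column_is_classical
    (a : Fin 3 → Fin 3 → EuclideanSpace ℂ (Fin 3))
    (hunit : ∀ i j, ‖a i j‖ = 1)
    (hrow : ∀ i : Fin 3, IsONB fun j : Fin 3 => a i j)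
    (hcol : ∀ j : Fin 3, IsONB fun i : Fin 3 => a i j)
    (hthird : ∀ i : Fin 3, a i 2 = E3 i) :
    ∀ i j : Fin 3, ∃ (k : Fin 3) (c : ℂ), ‖c‖ = 1 ∧ a i j = c • E3 k := by
  intro i j
  by_cases hj : j = 2
  · exact ⟨i, 1, by simp, by simp [hj, hthird]⟩
  have hdiag (i : Fin 3) : a i j i = 0 := by
    simpa [hthird, E3, EuclideanSpace.inner_single_left] using
      (hrow i).1.inner_eq_zero (Ne.symm hj)
  obtain ⟨k, hk⟩ := (hcol j).1.exists_support_singleton_of_diag_eq_zero hdiag i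
  exact ⟨k, exists_eq_smul_E3 (hunit i j) hk⟩
end

section
/- There exists a partial classical Sudoku grid of size 9 (with entries standard basis vectors of ℂ⁹) that admits exactly two fillings to SudoQ squares of size 9, and both of these fillings are classical: in every SudoQ square of size 9 extending this grid, each entry is a scalar multiple of a standard basis vector of ℂ⁹. In particular, this grid has more than one classical solution but admits no purely quantum solution. -/
/-- The standard basis of `ℂ⁹ ≅ ℂ^{Fin 3 × Fin 3}`. -/
noncomputable def qe (k : Fin 3 × Fin 3) : EuclideanSpace ℂ (Fin 3 × Fin 3) :=
  EuclideanSpace.single k 1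

/-- A classical Sudoku square of size 9: cells indexed by `((i,a),(b,j))`, with each
row `(i,a)`, column `(b,j)` and block `(i,b)` a bijection onto `Fin 3 × Fin 3 ≅ Fin 9`. -/
def IsSudoku (G : (Fin 3 × Fin 3) × (Fin 3 × Fin 3) → Fin 3 × Fin 3) : Prop :=
  (∀ ia : Fin 3 × Fin 3, Function.Bijective fun bj : Fin 3 × Fin 3 => G (ia, bj)) ∧
  (∀ bj : Fin 3 × Fin 3, Function.Bijective fun ia : Fin 3 × Fin 3 => G (ia, bj)) ∧
  (∀ i b : Fin 3, Function.Bijective fun aj : Fin 3 × Fin 3 => G ((i, aj.1), (b, aj.2)))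

/-- A SudoQ square of size 9: a unit vector of `ℂ⁹` at each cell, with the nine
vectors in each row, column and block forming an orthonormal basis of `ℂ⁹`. -/
def IsSudoQ (Q : (Fin 3 × Fin 3) × (Fin 3 × Fin 3) → EuclideanSpace ℂ (Fin 3 × Fin 3)) :
    Prop :=
  (∀ cell, ‖Q cell‖ = 1) ∧
  (∀ ia : Fin 3 × Fin 3, IsONB fun bj : Fin 3 × Fin 3 => Q (ia, bj)) ∧
  (∀ bj : Fin 3 × Fin 3, IsONB fun ia : Fin 3 × Fin 3 => Q (ia, bj)) ∧
  (∀ i b : Fin 3, IsONB fun aj : Fin 3 × Fin 3 => Q ((i, aj.1), (b, aj.2)))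

/-- The Sudoku square whose entry at `((i, a), (b, j))` is `(b + a, j + i)`. -/
def shiftSquare (c : (Fin 3 × Fin 3) × (Fin 3 × Fin 3)) : Fin 3 × Fin 3 :=
  (c.2.1 + c.1.2, c.2.2 + c.1.1)

/-- The six cells in rows `(0, 0)`, `(0, 1)` and columns `(b, 0)`. -/
def IsHole (c : (Fin 3 × Fin 3) × (Fin 3 × Fin 3)) : Prop :=
  c.1.1 = 0 ∧ c.2.2 = 0 ∧ c.1.2 ≠ 2

instance : DecidablePred IsHole := fun c =>
  inferInstanceAs (Decidable (c.1.1 = 0 ∧ c.2.2 = 0 ∧ c.1.2 ≠ 2))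

/-- `shiftSquare` with the two rows of holes exchanged. -/
def swappedSquare (c : (Fin 3 × Fin 3) × (Fin 3 × Fin 3)) : Fin 3 × Fin 3 :=
  if IsHole c then (c.2.1 + (1 - c.1.2), 0) else shiftSquare c

/-- `shiftSquare` with the six holes left blank. -/
def holedGrid (c : (Fin 3 × Fin 3) × (Fin 3 × Fin 3)) : Option (Fin 3 × Fin 3) :=
  if IsHole c then none else some (shiftSquare c)

lemma isSudoku_of_injective {G : (Fin 3 × Fin 3) × (Fin 3 × Fin 3) → Fin 3 × Fin 3}
    (hrow : ∀ ia : Fin 3 × Fin 3, Function.Injective fun bj : Fin 3 × Fin 3 => G (ia, bj))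
    (hcol : ∀ bj : Fin 3 × Fin 3, Function.Injective fun ia : Fin 3 × Fin 3 => G (ia, bj))
    (hblock : ∀ i b : Fin 3,
      Function.Injective fun aj : Fin 3 × Fin 3 => G ((i, aj.1), (b, aj.2))) :
    IsSudoku G :=
  ⟨fun ia => Finite.injective_iff_bijective.mp (hrow ia),
    fun bj => Finite.injective_iff_bijective.mp (hcol bj),
    fun i b => Finite.injective_iff_bijective.mp (hblock i b)⟩

set_option maxRecDepth 100000 in
lemma isSudoku_shiftSquare : IsSudoku shiftSquare :=
  isSudoku_of_injective (by decide) (by decide) (by decide)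

set_option maxRecDepth 100000 in
lemma isSudoku_swappedSquare : IsSudoku swappedSquare :=
  isSudoku_of_injective (by decide) (by decide) (by decide)

lemma isONB_qe_comp {ι : Type*} {f : ι → Fin 3 × Fin 3} (hf : Function.Bijective f) :
    IsONB fun i => qe (f i) := by
  have hqe : qe = EuclideanSpace.basisFun (Fin 3 × Fin 3) ℂ := by
    funext k
    simp [qe]
  change IsONB (qe ∘ f)
  rw [hqe]
  refine ⟨(EuclideanSpace.basisFun _ ℂ).orthonormal.comp f hf.injective, ?_⟩
  rw [hf.surjective.range_comp]
  simpa using (EuclideanSpace.basisFun (Fin 3 × Fin 3) ℂ).toBasis.span_eq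

/-- A classical Sudoku square gives a SudoQ square. -/
lemma IsSudoku.isSudoQ {B : (Fin 3 × Fin 3) × (Fin 3 × Fin 3) → Fin 3 × Fin 3}
    (hB : IsSudoku B) : IsSudoQ fun c => qe (B c) :=
  ⟨fun c => by simp [qe], fun ia => isONB_qe_comp (hB.1 ia),
    fun bj => isONB_qe_comp (hB.2.1 bj), fun i b => isONB_qe_comp (hB.2.2 i b)⟩

lemma eq_of_qe_eq_smul_qe {k l : Fin 3 × Fin 3} {c : ℂ} (h : qe k = c • qe l) : k = l := by
  by_contra hkl
  have := congrArg (fun x : EuclideanSpace ℂ (Fin 3 × Fin 3) => x k) h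
  simp [qe, hkl] at this

lemma eq_smul_qe_of_apply_eq_zero {u : EuclideanSpace ℂ (Fin 3 × Fin 3)} {k : Fin 3 × Fin 3}
    (h : ∀ l, l ≠ k → u l = 0) : u = u k • qe k := by
  ext l
  by_cases hl : l = k
  · subst hl
    simp [qe]
  · simp [qe, hl, h l hl]

lemma inner_eq_sum_of_support {u v : EuclideanSpace ℂ (Fin 3 × Fin 3)}
    (s : Finset (Fin 3 × Fin 3)) (h : ∀ k ∉ s, u k = 0 ∨ v k = 0) :
    inner ℂ u v = ∑ k ∈ s, v k * starRingEnd ℂ (u k) := by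
  rw [PiLp.inner_apply]
  refine (Finset.sum_subset (Finset.subset_univ s) fun k _ hk => ?_).symm
  rcases h k hk with h | h <;> simp [h]

/-- Three nonzero vectors, cyclically orthogonal, with the `b`-th one in the span of
the basis vectors `(b, 0)` and `(b + 1, 0)`: all point along the first basis vector,
or all along the second. -/
lemma cyclic_support {u : Fin 3 → EuclideanSpace ℂ (Fin 3 × Fin 3)}
    (hsupp : ∀ b k, k ≠ (b, 0) → k ≠ (b + 1, 0) → u b k = 0) (hne : ∀ b, u b ≠ 0)
    (horth : ∀ b, inner ℂ (u b) (u (b + 1)) = 0) :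
    (∀ b, u b (b + 1, 0) = 0) ∨ ∀ b, u b (b, 0) = 0 := by
  have hor : ∀ b, u b (b, 0) ≠ 0 ∨ u b (b + 1, 0) ≠ 0 := by
    intro b
    by_contra! h
    refine hne b (PiLp.ext fun k => ?_)
    by_cases h₁ : k = (b, 0)
    · simp [h₁, h.1]
    by_cases h₂ : k = (b + 1, 0)
    · simp [h₂, h.2]
    exact hsupp b k h₁ h₂
  have hmul : ∀ b, u (b + 1) (b + 1, 0) = 0 ∨ u b (b + 1, 0) = 0 := by
    intro b
    have h := horth b
    rw [inner_eq_sum_of_support {(b + 1, 0)}] at h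
    · simpa using h
    · intro k hk
      by_cases hkb : k = (b, 0)
      · right
        subst hkb
        have hb : ∀ b : Fin 3, (b, (0 : Fin 3)) ≠ (b + 1, 0) ∧ (b, (0 : Fin 3)) ≠ (b + 1 + 1, 0) := by
          decide
        exact hsupp _ _ (hb b).1 (hb b).2
      · exact Or.inl (hsupp b k hkb (by simpa using hk))
  by_cases h₀ : u 0 (0 + 1, 0) = 0
  · left
    have hstep : ∀ b, u (b + 1) (b + 1 + 1, 0) = 0 → u b (b + 1, 0) = 0 := fun b h =>
      (hmul b).resolve_left ((hor (b + 1)).resolve_right (not_not.mpr h))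
    have h₂ : u 2 (2 + 1, 0) = 0 := hstep 2 h₀
    have h₁ : u 1 (1 + 1, 0) = 0 := hstep 1 h₂
    intro b
    fin_cases b
    exacts [h₀, h₁, h₂]
  · right
    have hstep : ∀ b, u b (b + 1, 0) ≠ 0 → u (b + 1) (b + 1, 0) = 0 := fun b h =>
      (hmul b).resolve_right h
    have h₁ : u 1 (1, 0) = 0 := hstep 0 h₀
    have h₂ : u 2 (2, 0) = 0 := hstep 1 ((hor 1).resolve_left (not_not.mpr h₁))
    have h₃ : u 0 (0, 0) = 0 := hstep 2 ((hor 2).resolve_left (not_not.mpr h₂))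
    intro b
    fin_cases b
    exacts [h₃, h₁, h₂]

/-- Every SudoQ square extending `holedGrid` follows one of the two classical solutions. -/
lemma isSudoQ_extending_holedGrid
    {Q : (Fin 3 × Fin 3) × (Fin 3 × Fin 3) → EuclideanSpace ℂ (Fin 3 × Fin 3)}
    (hQ : IsSudoQ Q) (hext : ∀ cell v, holedGrid cell = some v → Q cell = qe v) :
    (∀ cell, ∃ c : ℂ, Q cell = c • qe (shiftSquare cell)) ∨
      (∀ cell, ∃ c : ℂ, Q cell = c • qe (swappedSquare cell)) := by
  obtain ⟨hnorm, hrow, hcol, -⟩ := hQ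
  have hgiven : ∀ c, ¬ IsHole c → Q c = qe (shiftSquare c) := fun c hc =>
    hext c _ (by simp [holedGrid, hc])
  have hne : ∀ c, Q c ≠ 0 := fun c h => by simpa [h] using hnorm c
  have hsupp : ∀ a, a ≠ 2 → ∀ b k, k ≠ (b, 0) → k ≠ (b + 1, 0) →
      Q ((0, a), (b, 0)) k = 0 := by
    intro a ha b k h₁ h₂
    have hnot : ¬ IsHole ((k.2, k.1 - b), (b, 0)) := by
      decide +revert
    have hk : shiftSquare ((k.2, k.1 - b), (b, 0)) = k := by
      simp [shiftSquare]
    have hdiff : (k.2, k.1 - b) ≠ (0, a) := fun h => hnot (by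
      rw [h]
      exact ⟨rfl, rfl, ha⟩)
    have h : inner ℂ (Q ((k.2, k.1 - b), (b, 0))) (Q ((0, a), (b, 0))) = 0 :=
      (hcol (b, 0)).1.2 hdiff
    rw [hgiven _ hnot, hk, qe, EuclideanSpace.inner_single_left] at h
    simpa using h
  have horth : ∀ a b, inner ℂ (Q ((0, a), (b, 0))) (Q ((0, a), (b + 1, 0))) = 0 := fun a b =>
    (hrow (0, a)).1.2 (by simp : (b, (0 : Fin 3)) ≠ (b + 1, 0))
  have hcolumn : ∀ b, Q ((0, 1), (b, 0)) (b, 0) * starRingEnd ℂ (Q ((0, 0), (b, 0)) (b, 0)) +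
      Q ((0, 1), (b, 0)) (b + 1, 0) * starRingEnd ℂ (Q ((0, 0), (b, 0)) (b + 1, 0)) = 0 := by
    intro b
    have h : inner ℂ (Q ((0, 0), (b, 0))) (Q ((0, 1), (b, 0))) = 0 :=
      (hcol (b, 0)).1.2 (by decide : ((0 : Fin 3), (0 : Fin 3)) ≠ (0, 1))
    rw [inner_eq_sum_of_support {(b, 0), (b + 1, 0)}, Finset.sum_pair (by simp)] at h
    · exact h
    · intro k hk
      simp only [Finset.mem_insert, Finset.mem_singleton, not_or] at hk
      exact Or.inl (hsupp 0 (by decide) b k hk.1 hk.2)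
  have hfirst : ∀ a, a ≠ 2 → ∀ b, Q ((0, a), (b, 0)) (b + 1, 0) = 0 →
      Q ((0, a), (b, 0)) = Q ((0, a), (b, 0)) (b, 0) • qe (b, 0) := fun a ha b h =>
    eq_smul_qe_of_apply_eq_zero fun l hl => by
      by_cases hl' : l = (b + 1, 0)
      · rw [hl', h]
      · exact hsupp a ha b l hl hl'
  have hsecond : ∀ a, a ≠ 2 → ∀ b, Q ((0, a), (b, 0)) (b, 0) = 0 →
      Q ((0, a), (b, 0)) = Q ((0, a), (b, 0)) (b + 1, 0) • qe (b + 1, 0) := fun a ha b h =>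
    eq_smul_qe_of_apply_eq_zero fun l hl => by
      by_cases hl' : l = (b, 0)
      · rw [hl', h]
      · exact hsupp a ha b l hl' hl
  rcases cyclic_support (hsupp 0 (by decide)) (fun b => hne _) (horth 0) with h₀ | h₀
  · left
    have h₁ : ∀ b, Q ((0, 1), (b, 0)) (b, 0) = 0 := by
      intro b
      have hx : Q ((0, 0), (b, 0)) (b, 0) ≠ 0 := fun hx =>
        hne ((0, 0), (b, 0)) (by rw [hfirst 0 (by decide) b (h₀ b), hx, zero_smul])
      simpa [h₀ b, hx] using hcolumn b
    rintro ⟨⟨i, a⟩, b, j⟩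
    by_cases hc : IsHole ((i, a), (b, j))
    · obtain ⟨rfl, rfl, ha⟩ : i = 0 ∧ j = 0 ∧ a ≠ 2 := hc
      obtain rfl | rfl : a = 0 ∨ a = 1 := by decide +revert
      · exact ⟨_, by simpa [shiftSquare] using hfirst 0 ha b (h₀ b)⟩
      · exact ⟨_, by simpa [shiftSquare] using hsecond 1 ha b (h₁ b)⟩
    · exact ⟨1, by rw [one_smul, hgiven _ hc]⟩
  · right
    have h₁ : ∀ b, Q ((0, 1), (b, 0)) (b + 1, 0) = 0 := by
      intro b
      have hx : Q ((0, 0), (b, 0)) (b + 1, 0) ≠ 0 := fun hx =>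
        hne ((0, 0), (b, 0)) (by rw [hsecond 0 (by decide) b (h₀ b), hx, zero_smul])
      simpa [h₀ b, hx] using hcolumn b
    rintro ⟨⟨i, a⟩, b, j⟩
    by_cases hc : IsHole ((i, a), (b, j))
    · have hsw : swappedSquare ((i, a), (b, j)) = (b + (1 - a), 0) := if_pos hc
      rw [hsw]
      obtain ⟨rfl, rfl, ha⟩ : i = 0 ∧ j = 0 ∧ a ≠ 2 := hc
      obtain rfl | rfl : a = 0 ∨ a = 1 := by decide +revert
      · exact ⟨_, by simpa using hsecond 0 ha b (h₀ b)⟩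
      · exact ⟨_, by simpa using hfirst 1 ha b (h₁ b)⟩
    · exact ⟨1, by rw [one_smul, hgiven _ hc, swappedSquare, if_neg hc]⟩

/-- There exists a partial classical Sudoku grid of size 9 having exactly two
classical solutions, such that every SudoQ square of size 9 extending it is
classical: every entry is a scalar multiple of a standard basis vector, and the
entries follow one of the two classical solutions. In particular, this grid has
more than one classical solution but no purely quantum solution. -/
theorem two_classical_solutions_no_quantum :
    ∃ (A : (Fin 3 × Fin 3) × (Fin 3 × Fin 3) → Option (Fin 3 × Fin 3))
      (B1 B2 : (Fin 3 × Fin 3) × (Fin 3 × Fin 3) → Fin 3 × Fin 3),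
      B1 ≠ B2 ∧ IsSudoku B1 ∧ IsSudoku B2 ∧
      (∀ cell v, A cell = some v → B1 cell = v) ∧
      (∀ cell v, A cell = some v → B2 cell = v) ∧
      (∀ B, IsSudoku B → (∀ cell v, A cell = some v → B cell = v) → B = B1 ∨ B = B2) ∧
      (∀ Q, IsSudoQ Q → (∀ cell v, A cell = some v → Q cell = qe v) →
        (∀ cell, ∃ (k : Fin 3 × Fin 3) (c : ℂ), Q cell = c • qe k)) ∧
      (∀ Q, IsSudoQ Q → (∀ cell v, A cell = some v → Q cell = qe v) →
        (∀ cell, ∃ c : ℂ, Q cell = c • qe (B1 cell)) ∨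
        (∀ cell, ∃ c : ℂ, Q cell = c • qe (B2 cell))) := by
  refine ⟨holedGrid, shiftSquare, swappedSquare, ?_, isSudoku_shiftSquare,
    isSudoku_swappedSquare, ?_, ?_, ?_, ?_, fun Q => isSudoQ_extending_holedGrid⟩
  · exact fun h => absurd (congrFun h ((0, 0), (0, 0))) (by decide)
  · intro cell v h
    by_cases hc : IsHole cell <;> simp_all [holedGrid]
  · intro cell v h
    by_cases hc : IsHole cell <;> simp_all [holedGrid, swappedSquare]
  · intro B hB hext
    refine (isSudoQ_extending_holedGrid hB.isSudoQ fun cell v h => by rw [hext cell v h]).imp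
      ?_ ?_ <;>
    · intro h
      funext cell
      obtain ⟨c, hc⟩ := h cell
      exact eq_of_qe_eq_smul_qe hc
  · intro Q hQ hext cell
    rcases isSudoQ_extending_holedGrid hQ hext with h | h
    · exact ⟨_, h cell⟩
    · exact ⟨_, h cell⟩
end
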